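/- Exact pointwise mass conservation at the discrete level: if the degrees of freedom satisfy the incidence relation f_{i,j} = ux_{i,j} − ux_{i−1,j} + uy_{i,j} − uy_{i,j−1} for all i, j ∈ {1,…,N}, then the divergence of the discrete velocity equals the discrete source exactly everywhere, i.e. ∇ · u^h(x,y) = f^h(x,y) for all (x, y) ∈ ℝ². -/

import Mathlib

open Polynomial Finset

theorem sum_range_mul_sub_succ {R : Type*} [CommRing R] (a E : ℕ → R) (n : ℕ) :
    ∑ i ∈ Finset.range (n + 1), a i * (E i - E (i + 1))
      = a 0 * E 0 + ∑ i ∈ Finset.Icc 1 n, (a i - a (i - 1)) * E i - a n * E (n + 1) := by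
  induction n with
  | zero => simp [mul_sub]
  | succ n ih =>
    rw [Finset.sum_range_succ, ih, Finset.sum_Icc_succ_top (by omega), Nat.add_sub_cancel]
    ring

theorem sum_lagrange_eq_one {K : Type*} [Field K] (N : ℕ) (ξ : ℕ → K)
    (hξ : Set.InjOn ξ (Finset.range (N + 1))) (h : ℕ → Polynomial K)
    (hdeg : ∀ i, i ≤ N → (h i).degree ≤ (N : ℕ))
    (hval : ∀ i, i ≤ N → ∀ j, j ≤ N → (h i).eval (ξ j) = if i = j then 1 else 0) :
    ∑ k ∈ Finset.range (N + 1), h k = 1 := by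
  have hlt : ((N : ℕ) : WithBot ℕ) < ((Finset.range (N + 1)).card : ℕ) := by
    rw [Finset.card_range]
    exact_mod_cast Nat.lt_succ_self N
  refine Polynomial.eq_of_degrees_lt_of_eval_index_eq (Finset.range (N + 1)) hξ ?_ ?_ ?_
  · refine lt_of_le_of_lt ((Polynomial.degree_sum_le _ _).trans (Finset.sup_le fun k hk => ?_)) hlt
    exact hdeg k (Finset.mem_range_succ_iff.1 hk)
  · refine lt_of_le_of_lt (Polynomial.degree_one_le.trans ?_) hlt
    exact_mod_cast Nat.zero_le N
  · intro j hj
    rw [Polynomial.eval_finsetSum, Polynomial.eval_one, Finset.sum_congr rfl fun k hk =>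
      hval k (Finset.mem_range_succ_iff.1 hk) j (Finset.mem_range_succ_iff.1 hj)]
    simpa using hj

/-- Differentiating a nodal expansion gives the edge expansion with differenced coefficients. -/
theorem deriv_sum_lagrange {N : ℕ} {h e : ℕ → Polynomial ℝ}
    (hsum : ∑ k ∈ Finset.range (N + 1), h k = 1)
    (he : ∀ j, e j = -∑ k ∈ Finset.range j, derivative (h k)) (a : ℕ → ℝ) (x : ℝ) :
    deriv (fun t : ℝ => ∑ i ∈ Finset.range (N + 1), a i * (h i).eval t) x
      = ∑ i ∈ Finset.Icc 1 N, (a i - a (i - 1)) * (e i).eval x := by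
  have hder : ∀ i, (derivative (h i)).eval x = (e i).eval x - (e (i + 1)).eval x := by
    intro i
    rw [← Polynomial.eval_sub, he i, he (i + 1), Finset.sum_range_succ]
    congr 1
    ring
  have hfirst : e 0 = 0 := by simp [he]
  have hlast : e (N + 1) = 0 := by
    rw [he, ← Polynomial.derivative_sum, hsum, Polynomial.derivative_one, neg_zero]
  have hd := HasDerivAt.fun_sum (u := Finset.range (N + 1))
    fun i _ => ((h i).hasDerivAt x).const_mul (a i)
  rw [hd.deriv]
  simp_rw [hder]
  rw [sum_range_mul_sub_succ a (fun i => (e i).eval x), hfirst, hlast]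
  simp

/-- **Exact pointwise discrete mass conservation.**
With nodes `ξ 0 < … < ξ N`, Lagrange basis polynomials `h i`, edge polynomials
`e j = -∑_{k=0}^{j-1} (h k)'`, velocity degrees of freedom `ux, uy` and source
degrees of freedom `f`: if `f i j = ux i j - ux (i-1) j + uy i j - uy i (j-1)` for
all `i, j ∈ {1, …, N}`, then `∇ · u^h (x, y) = f^h (x, y)` for all `(x, y) ∈ ℝ²`,
where `u^h = (∑ᵢ∑ⱼ ux i j · h i (x) e j (y), ∑ᵢ∑ⱼ uy i j · e i (x) h j (y))` and
`f^h (x, y) = ∑ᵢ∑ⱼ f i j · e i (x) e j (y)`. -/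
theorem discrete_divergence_eq_discrete_source
    (N : ℕ) (hN : 1 ≤ N)
    (ξ : ℕ → ℝ) (hξ : ∀ i j, i < j → j ≤ N → ξ i < ξ j)
    (h : ℕ → Polynomial ℝ)
    (hdeg : ∀ i, i ≤ N → (h i).degree ≤ (N : ℕ))
    (hval : ∀ i, i ≤ N → ∀ j, j ≤ N → (h i).eval (ξ j) = if i = j then 1 else 0)
    (e : ℕ → Polynomial ℝ)
    (he : ∀ j, e j = -∑ k ∈ Finset.range j, derivative (h k))
    (ux uy f : ℕ → ℕ → ℝ)
    (hf : ∀ i j, 1 ≤ i → i ≤ N → 1 ≤ j → j ≤ N →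
      f i j = ux i j - ux (i - 1) j + uy i j - uy i (j - 1)) :
    ∀ x y : ℝ,
      deriv (fun x' : ℝ => ∑ i ∈ Finset.range (N + 1), ∑ j ∈ Finset.Icc 1 N,
          ux i j * (h i).eval x' * (e j).eval y) x
      + deriv (fun y' : ℝ => ∑ i ∈ Finset.Icc 1 N, ∑ j ∈ Finset.range (N + 1),
          uy i j * (e i).eval x * (h j).eval y') y
      = ∑ i ∈ Finset.Icc 1 N, ∑ j ∈ Finset.Icc 1 N,
          f i j * (e i).eval x * (e j).eval y := by
  have hinj : Set.InjOn ξ (Finset.range (N + 1)) := by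
    refine StrictMonoOn.injOn fun i _ j hj hij => hξ i j hij ?_
    exact Finset.mem_range_succ_iff.1 hj
  have hsum := sum_lagrange_eq_one N ξ hinj h hdeg hval
  intro x y
  have hx : ∀ t : ℝ, ∑ i ∈ Finset.range (N + 1), ∑ j ∈ Finset.Icc 1 N,
        ux i j * (h i).eval t * (e j).eval y
      = ∑ i ∈ Finset.range (N + 1),
        (∑ j ∈ Finset.Icc 1 N, ux i j * (e j).eval y) * (h i).eval t := fun t => by
    simp_rw [Finset.sum_mul, mul_right_comm]
  have hy : ∀ t : ℝ, ∑ i ∈ Finset.Icc 1 N, ∑ j ∈ Finset.range (N + 1),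
        uy i j * (e i).eval x * (h j).eval t
      = ∑ j ∈ Finset.range (N + 1),
        (∑ i ∈ Finset.Icc 1 N, uy i j * (e i).eval x) * (h j).eval t := fun t => by
    rw [Finset.sum_comm]
    simp_rw [Finset.sum_mul]
  simp_rw [hx, hy]
  rw [deriv_sum_lagrange hsum he, deriv_sum_lagrange hsum he]
  simp_rw [← Finset.sum_sub_distrib, Finset.sum_mul]
  rw [Finset.sum_comm (f := fun j i => (uy i j * _ - uy i (j - 1) * _) * _),
    ← Finset.sum_add_distrib]
  refine Finset.sum_congr rfl fun i hi => ?_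
  rw [← Finset.sum_add_distrib]
  refine Finset.sum_congr rfl fun j hj => ?_
  rw [Finset.mem_Icc] at hi hj
  rw [hf i j hi.1 hi.2 hj.1 hj.2]
  ring
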